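/- Consider the attitude kinematics and observer on SO(3): R, R̄ : ℝ → ℝ³ˣ³ are differentiable with R(t), R̄(t) ∈ SO(3) for all t ≥ 0, Ω : ℝ → ℝ³ satisfies ‖Ω(t)‖ ≤ B_Ω, γ ∈ ℝ³ is a constant gyro bias, γ̄ : ℝ → ℝ³ is differentiable, s₁,…,sₙ : ℝ → ℝ³ are differentiable with ‖sᵢ(t)‖ = 1, wᵢ > 0, G(t) = Σᵢ wᵢ sᵢ(t)sᵢ(t)ᵀ, e_R(t) = (R(t)ᵀG(t)R̄(t) − R̄(t)ᵀG(t)R(t))^∨, and the equations R′(t) = R(t)·(Ω(t))^, R̄′(t) = R̄(t)·(Ω(t) + γ − γ̄(t) − k_R e_R(t))^, γ̄′(t) = k_γ e_R(t) hold for positive gains k_R, k_γ. Set E_R(t) = R(t) − R̄(t), e_γ(t) = γ − γ̄(t), Ψ(t) = ½⟨G(t)E_R(t), E_R(t)⟩, and z(t) = (‖E_R(t)‖, ‖e_γ(t)‖) ∈ ℝ². Assume there are constants 0 < c₁ ≤ c₂ and d > 0 such that for all t ≥ 0 the eigenvalues λ₁(t) ≤ λ₂(t) ≤ λ₃(t)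 of G(t) satisfy λ₁(t)+λ₂(t) ≥ c₁ and λ₂(t)+λ₃(t) ≤ c₂, and ‖G′(t)‖ ≤ d. Assume k_R > 2d/c₁². Fix a ∈ (0, ½) and a constant μ > 0 with μ < min{ √(c₁/(4k_γ)), ((1−a)c₁²k_R − d)/(2c₂k_γ), (½(1−2a)·((1−a)c₁²k_R − d)) / ((c₂k_R + B_Ω/2)² + c₂k_R(1−2a)) }. Define the 2×2 matrices M₁ = [[c₁/4, −(√2/2)μ], [−(√2/2)μ, 1/(2k_γ)]], M₂ = [[c₂/4, (√2/2)μ], [(√2/2)μ, 1/(2k_γ)]], M₃ = [[½((1−a)c₁²k_R − d) − μc₂k_γ, −μ√2(c₂k_R + B_Ω/2)], [−μ√2(c₂k_R + B_Ω/2), 2μ(1−2a)]], and set β = √(λ_max(M₂)/λ_min(M₁)), σ = λ_min(M₃)/λ_max(M₂). If the initial condition satisfies Ψ(0) + (1/(2k_γ))‖e_γ(0)‖² ≤ 2a·c₁, then for all t ≥ 0, ‖z(t)‖ ≤ β·‖z(0)‖·e^{−σt/2}; in particular (R̄, γ̄) = (R, γ) is locally exponentially stable. -/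

import Mathlib

open Matrix Polynomial

noncomputable section

/-- The hat map sending `x ∈ ℝ³` to the skew-symmetric matrix `x̂` with `x̂ y = x × y`. -/
def hat (x : Fin 3 → ℝ) : Matrix (Fin 3) (Fin 3) ℝ :=
  !![0, -x 2, x 1; x 2, 0, -x 0; -x 1, x 0, 0]

/-- The vee map, inverse of the hat map on skew-symmetric `3 × 3` matrices. -/
def vee (A : Matrix (Fin 3) (Fin 3) ℝ) : Fin 3 → ℝ :=
  ![A 2 1, A 0 2, A 1 0]

/-- `SO3 R` iff `R` is a rotation matrix: `RᵀR = I₃` and `det R = 1`. -/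
def SO3 (R : Matrix (Fin 3) (Fin 3) ℝ) : Prop :=
  Rᵀ * R = 1 ∧ R.det = 1

/-- Frobenius inner product `⟨A,B⟩ = tr(AᵀB)`. -/
def finner (A B : Matrix (Fin 3) (Fin 3) ℝ) : ℝ := (Aᵀ * B).trace

/-- Frobenius norm `‖A‖ = √⟨A,A⟩`. -/
def fnorm (A : Matrix (Fin 3) (Fin 3) ℝ) : ℝ := Real.sqrt (finner A A)

/-- Euclidean norm of a vector. -/
def vnorm {k : ℕ} (x : Fin k → ℝ) : ℝ := Real.sqrt (x ⬝ᵥ x)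

/-- Third standard basis vector `e₃ = (0,0,1)` of `ℝ³`. -/
def e3 : Fin 3 → ℝ := ![0, 0, 1]

/-- Smallest eigenvalue of a symmetric `2 × 2` real matrix `M` (for symmetric `M`,
`λ_min(M) = (M₁₁ + M₂₂ − √((M₁₁−M₂₂)² + 4 M₁₂²))/2`). -/
def lamMin (M : Matrix (Fin 2) (Fin 2) ℝ) : ℝ :=
  ((M 0 0 + M 1 1) - Real.sqrt ((M 0 0 - M 1 1) ^ 2 + 4 * M 0 1 ^ 2)) / 2

/-- Largest eigenvalue of a symmetric `2 × 2` real matrix `M` (for symmetric `M`,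
`λ_max(M) = (M₁₁ + M₂₂ + √((M₁₁−M₂₂)² + 4 M₁₂²))/2`). -/
def lamMax (M : Matrix (Fin 2) (Fin 2) ℝ) : ℝ :=
  ((M 0 0 + M 1 1) + Real.sqrt ((M 0 0 - M 1 1) ^ 2 + 4 * M 0 1 ^ 2)) / 2

/-- The rotation matrix of the unit quaternion `q₀ + q`. -/
def quatRot (q₀ : ℝ) (q : Fin 3 → ℝ) : Matrix (Fin 3) (Fin 3) ℝ :=
  1 + (2 * q₀) • hat q + (2 : ℝ) • (hat q * hat q)

lemma SO3.exists_quatRot {A : Matrix (Fin 3) (Fin 3) ℝ} (hA : SO3 A) :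
    ∃ (q₀ : ℝ) (q : Fin 3 → ℝ), q₀ ^ 2 + q ⬝ᵥ q = 1 ∧ A = quatRot q₀ q := by
  obtain ⟨h1, hdet⟩ := hA
  have h2 : A * Aᵀ = 1 := mul_eq_one_comm.mp h1
  have h3 : A.adjugate = Aᵀ := by
    calc A.adjugate = (Aᵀ * A) * A.adjugate := by rw [h1, one_mul]
      _ = Aᵀ := by rw [mul_assoc, mul_adjugate, hdet, one_smul, mul_one]
  have o1 := fun i j => congrFun (congrFun h1 i) j
  have o2 := fun i j => congrFun (congrFun h2 i) j
  have o3 := fun i j => congrFun (congrFun h3 i) j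
  rw [adjugate_fin_three] at o3
  simp only [mul_apply, Fin.sum_univ_three, transpose_apply, one_apply] at o1 o2
  have c00 := o1 0 0
  have c01 := o1 0 1
  have c02 := o1 0 2
  have c11 := o1 1 1
  have c12 := o1 1 2
  have c22 := o1 2 2
  have d00 := o2 0 0
  have d01 := o2 0 1
  have d02 := o2 0 2
  have d11 := o2 1 1
  have d12 := o2 1 2
  have d22 := o2 2 2
  have f00 := o3 0 0
  have f01 := o3 0 1
  have f02 := o3 0 2
  have f10 := o3 1 0
  have f11 := o3 1 1
  have f12 := o3 1 2
  have f20 := o3 2 0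
  have f21 := o3 2 1
  have f22 := o3 2 2
  clear o1 o2 o3 h1 h2 h3 hdet
  simp at c00 c01 c02 c11 c12 c22 d00 d01 d02 d11 d12 d22 f00 f01 f02 f10 f11 f12 f20 f21 f22
  have key : ∀ k x₀ x₁ x₂ x₃ : ℝ, 0 < k →
      x₀ * x₀ = k * (1 + A 0 0 + A 1 1 + A 2 2) → x₁ * x₁ = k * (1 + A 0 0 - A 1 1 - A 2 2) →
      x₂ * x₂ = k * (1 - A 0 0 + A 1 1 - A 2 2) → x₃ * x₃ = k * (1 - A 0 0 - A 1 1 + A 2 2) →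
      x₀ * x₁ = k * (A 2 1 - A 1 2) → x₀ * x₂ = k * (A 0 2 - A 2 0) →
      x₀ * x₃ = k * (A 1 0 - A 0 1) → x₁ * x₂ = k * (A 0 1 + A 1 0) →
      x₁ * x₃ = k * (A 0 2 + A 2 0) → x₂ * x₃ = k * (A 1 2 + A 2 1) →
      ∃ (q₀ : ℝ) (q : Fin 3 → ℝ), q₀ ^ 2 + q ⬝ᵥ q = 1 ∧ A = quatRot q₀ q := by
    intro k x₀ x₁ x₂ x₃ hk h00 h11 h22 h33 h01 h02 h03 h12 h13 h23
    obtain ⟨r, hr, hrk⟩ : ∃ r : ℝ, r ≠ 0 ∧ r * r * k = 1 / 4 :=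
      ⟨1 / (2 * √k), by positivity, by
        have := Real.sq_sqrt hk.le
        field_simp
        linarith⟩
    have hs : ∀ x y K : ℝ, x * y = k * K → (r * x) * (r * y) = K / 4 := by
      intro x y K h
      linear_combination r * r * h + K * hrk
    have g00 := hs _ _ _ h00
    have g11 := hs _ _ _ h11
    have g22 := hs _ _ _ h22
    have g33 := hs _ _ _ h33
    have g01 := hs _ _ _ h01
    have g02 := hs _ _ _ h02
    have g03 := hs _ _ _ h03
    have g12 := hs _ _ _ h12
    have g13 := hs _ _ _ h13
    have g23 := hs _ _ _ h23
    refine ⟨r * x₀, ![r * x₁, r * x₂, r * x₃], ?_, ?_⟩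
    · simp [dotProduct, Fin.sum_univ_three]
      linarith
    · ext i j
      fin_cases i <;> fin_cases j <;>
        simp [quatRot, hat] <;> linarith
  by_cases p0 : 0 < 1 + A 0 0 + A 1 1 + A 2 2
  · refine key _ (1 + A 0 0 + A 1 1 + A 2 2) (A 2 1 - A 1 2) (A 0 2 - A 2 0) (A 1 0 - A 0 1)
      p0 ?_ ?_ ?_ ?_ ?_ ?_ ?_ ?_ ?_ ?_ <;> linarith
  by_cases p1 : 0 < 1 + A 0 0 - A 1 1 - A 2 2
  · refine key _ (A 2 1 - A 1 2) (1 + A 0 0 - A 1 1 - A 2 2) (A 0 1 + A 1 0) (A 0 2 + A 2 0)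
      p1 ?_ ?_ ?_ ?_ ?_ ?_ ?_ ?_ ?_ ?_ <;> linarith
  by_cases p2 : 0 < 1 - A 0 0 + A 1 1 - A 2 2
  · refine key _ (A 0 2 - A 2 0) (A 0 1 + A 1 0) (1 - A 0 0 + A 1 1 - A 2 2) (A 1 2 + A 2 1)
      p2 ?_ ?_ ?_ ?_ ?_ ?_ ?_ ?_ ?_ ?_ <;> linarith
  · refine key (1 - A 0 0 - A 1 1 + A 2 2)
      (A 1 0 - A 0 1) (A 0 2 + A 2 0) (A 1 2 + A 2 1) (1 - A 0 0 - A 1 1 + A 2 2)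
      (by linarith) ?_ ?_ ?_ ?_ ?_ ?_ ?_ ?_ ?_ ?_ <;> linarith

/-- The operator `tr B - B`, whose eigenvalues are the sums of pairs of eigenvalues of `B`. -/
def pairSum (B : Matrix (Fin 3) (Fin 3) ℝ) : Matrix (Fin 3) (Fin 3) ℝ :=
  B.trace • 1 - B

lemma trace_eq_of_charpoly_eq {B : Matrix (Fin 3) (Fin 3) ℝ} {l₁ l₂ l₃ : ℝ}
    (h : B.charpoly = (X - C l₁) * (X - C l₂) * (X - C l₃)) : B.trace = l₁ + l₂ + l₃ := by
  have hev : ∀ r : ℝ, (scalar (Fin 3) r - B).det = (r - l₁) * (r - l₂) * (r - l₃) := by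
    intro r
    rw [← eval_charpoly, h]
    simp
  have h0 := hev 0
  have h1 := hev 1
  have h2 := hev (-1)
  simp [det_fin_three] at h0 h1 h2
  simp [trace, Fin.sum_univ_three]
  linarith

lemma pairSum_quadratic_form_bounds {B : Matrix (Fin 3) (Fin 3) ℝ} (hB : Bᵀ = B)
    {l₁ l₂ l₃ c₁ c₂ : ℝ} (h : B.charpoly = (X - C l₁) * (X - C l₂) * (X - C l₃))
    (h₁₂ : l₁ ≤ l₂) (h₂₃ : l₂ ≤ l₃) (hc₁ : c₁ ≤ l₁ + l₂) (hc₂ : l₂ + l₃ ≤ c₂)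
    (x : Fin 3 → ℝ) :
    c₁ * (x ⬝ᵥ x) ≤ x ⬝ᵥ (pairSum B *ᵥ x) ∧ x ⬝ᵥ (pairSum B *ᵥ x) ≤ c₂ * (x ⬝ᵥ x) := by
  have hroot : ∀ (r : ℝ) (v : Fin 3 → ℝ), v ≠ 0 → B *ᵥ v = r • v → r = l₁ ∨ r = l₂ ∨ r = l₃ := by
    intro r v hv hr
    have hdet : (scalar (Fin 3) r - B).det = 0 :=
      exists_mulVec_eq_zero_iff.mp ⟨v, hv, by
        rw [sub_mulVec, hr]; simp [scalar_apply, ← smul_one_eq_diagonal, smul_mulVec]⟩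
    rw [← eval_charpoly, h] at hdet
    simpa [sub_eq_zero, or_assoc] using hdet
  have htr := trace_eq_of_charpoly_eq h
  have hBh : B.IsHermitian := by rw [IsHermitian, conjTranspose_eq_transpose_of_trivial, hB]
  have hpsd : ∀ α ε : ℝ, (∀ r, r = l₁ ∨ r = l₂ ∨ r = l₃ → 0 ≤ α + ε * r) →
      0 ≤ x ⬝ᵥ ((α • (1 : Matrix (Fin 3) (Fin 3) ℝ) + ε • B) *ᵥ x) := by
    intro α ε hr
    by_cases hε : ε = 0
    · have := hr l₁ (Or.inl rfl)
      subst hε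
      simp only [zero_mul, add_zero, zero_smul, smul_mulVec, one_mulVec, dotProduct_smul] at this ⊢
      exact mul_nonneg this (dotProduct_self_star_nonneg x)
    have hH : (α • (1 : Matrix (Fin 3) (Fin 3) ℝ) + ε • B).IsHermitian := by
      rw [IsHermitian, conjTranspose_eq_transpose_of_trivial]
      simp [hB]
    have hP : (α • (1 : Matrix (Fin 3) (Fin 3) ℝ) + ε • B).PosSemidef := by
      rw [hH.posSemidef_iff_eigenvalues_nonneg]
      intro i
      have hv := hH.mulVec_eigenvectorBasis i
      have hv0 : (hH.eigenvectorBasis i).ofLp ≠ 0 := by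
        intro h0
        exact hH.eigenvectorBasis.orthonormal.ne_zero i (by ext j; simp [h0])
      generalize hH.eigenvalues i = e at *
      generalize (hH.eigenvectorBasis i).ofLp = v at *
      have : B *ᵥ v = ((e - α) / ε) • v := by
        rw [add_mulVec, smul_mulVec, smul_mulVec, one_mulVec] at hv
        ext j
        have := congrFun hv j
        simp only [Pi.add_apply, Pi.smul_apply, smul_eq_mul] at this ⊢
        field_simp
        linarith
      have h2 := hr _ (hroot _ v hv0 this)
      rw [mul_div_cancel₀ _ hε] at h2
      simpa using h2
    simpa using hP.dotProduct_mulVec_nonneg x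
  have hlo := hpsd (B.trace - c₁) (-1) (by rintro r (rfl | rfl | rfl) <;> linarith)
  have hhi := hpsd (c₂ - B.trace) 1 (by rintro r (rfl | rfl | rfl) <;> linarith)
  simp only [pairSum, add_mulVec, sub_mulVec, smul_mulVec, one_mulVec, dotProduct_add,
    dotProduct_sub, dotProduct_smul, smul_eq_mul] at hlo hhi ⊢
  constructor <;> linarith

lemma pairSum_norm_sq_le {B : Matrix (Fin 3) (Fin 3) ℝ} (hB : Bᵀ = B) {c₂ : ℝ} (hc₂ : 0 < c₂)
    (h : ∀ x, 0 ≤ x ⬝ᵥ (pairSum B *ᵥ x) ∧ x ⬝ᵥ (pairSum B *ᵥ x) ≤ c₂ * (x ⬝ᵥ x))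
    (x : Fin 3 → ℝ) :
    (pairSum B *ᵥ x) ⬝ᵥ (pairSum B *ᵥ x) ≤ c₂ ^ 2 * (x ⬝ᵥ x) := by
  have hsymm : ∀ u v, u ⬝ᵥ (pairSum B *ᵥ v) = (pairSum B *ᵥ u) ⬝ᵥ v := by
    intro u v
    rw [dotProduct_mulVec, ← mulVec_transpose]
    simp [pairSum, hB]
  set y := pairSum B *ᵥ x with hy
  have h1 := (h (c₂ • x - y)).1
  have h2 := (h y).2
  have h3 := (h x).2
  rw [mulVec_sub, mulVec_smul, ← hy, sub_dotProduct, dotProduct_sub, dotProduct_sub,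
    smul_dotProduct, smul_dotProduct, dotProduct_smul, dotProduct_smul, hsymm x y, ← hy] at h1
  simp only [smul_eq_mul] at h1
  have h4 : c₂ * (y ⬝ᵥ y) ≤ c₂ * (c₂ * (x ⬝ᵥ y)) := by linarith
  have h5 := le_of_mul_le_mul_left h4 hc₂
  nlinarith

lemma hat_mulVec_dotProduct_self (x y : Fin 3 → ℝ) :
    (hat x *ᵥ y) ⬝ᵥ (hat x *ᵥ y) = (x ⬝ᵥ x) * (y ⬝ᵥ y) - (x ⬝ᵥ y) ^ 2 := by
  simp [hat, mulVec, dotProduct, Fin.sum_univ_three]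
  ring

lemma dotProduct_sq_le (x y : Fin 3 → ℝ) : (x ⬝ᵥ y) ^ 2 ≤ (x ⬝ᵥ x) * (y ⬝ᵥ y) := by
  have h : 0 ≤ (hat x *ᵥ y) ⬝ᵥ (hat x *ᵥ y) := dotProduct_self_star_nonneg _
  rw [hat_mulVec_dotProduct_self] at h
  linarith

lemma quatRot_trace (q₀ : ℝ) (q : Fin 3 → ℝ) : (quatRot q₀ q).trace = 3 - 4 * (q ⬝ᵥ q) := by
  simp [quatRot, hat, trace, dotProduct, Fin.sum_univ_three]
  ring

lemma trace_mul_quatRot {B : Matrix (Fin 3) (Fin 3) ℝ} (hB : Bᵀ = B) (q₀ : ℝ) (q : Fin 3 → ℝ) :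
    B.trace - (B * quatRot q₀ q).trace = 2 * (q ⬝ᵥ (pairSum B *ᵥ q)) := by
  have h := fun i j => congrFun (congrFun hB i) j
  have h01 := h 0 1
  have h02 := h 0 2
  have h12 := h 1 2
  simp only [transpose_apply] at h01 h02 h12
  simp [quatRot, pairSum, hat, trace, mulVec, mul_apply, dotProduct, Fin.sum_univ_three,
    h01, h02, h12]
  ring

lemma vee_mul_quatRot {B : Matrix (Fin 3) (Fin 3) ℝ} (hB : Bᵀ = B) (q₀ : ℝ) (q : Fin 3 → ℝ) :
    vee (B * quatRot q₀ q - (B * quatRot q₀ q)ᵀ) =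
      (2 * q₀) • (pairSum B *ᵥ q) - (2 : ℝ) • (hat q *ᵥ (pairSum B *ᵥ q)) := by
  have h := fun i j => congrFun (congrFun hB i) j
  have h01 := h 0 1
  have h02 := h 0 2
  have h12 := h 1 2
  simp only [transpose_apply] at h01 h02 h12
  ext i
  fin_cases i <;>
    simp [-mulVec_mulVec, vee, quatRot, pairSum, hat, trace, mulVec, mul_apply, dotProduct,
      Fin.sum_univ_three, h01, h02, h12] <;> ring

lemma vee_mul_quatRot_dotProduct_self {B : Matrix (Fin 3) (Fin 3) ℝ} (hB : Bᵀ = B) {q₀ : ℝ}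
    {q : Fin 3 → ℝ} (hq : q₀ ^ 2 + q ⬝ᵥ q = 1) :
    vee (B * quatRot q₀ q - (B * quatRot q₀ q)ᵀ) ⬝ᵥ vee (B * quatRot q₀ q - (B * quatRot q₀ q)ᵀ) =
      4 * ((pairSum B *ᵥ q) ⬝ᵥ (pairSum B *ᵥ q) - (q ⬝ᵥ (pairSum B *ᵥ q)) ^ 2) := by
  rw [vee_mul_quatRot hB]
  generalize pairSum B *ᵥ q = p
  have h1 := hat_mulVec_dotProduct_self q p
  have h2 : p ⬝ᵥ (hat q *ᵥ p) = 0 := by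
    simp [hat, mulVec, dotProduct, Fin.sum_univ_three]
    ring
  simp only [sub_dotProduct, dotProduct_sub, smul_dotProduct, dotProduct_smul, smul_eq_mul,
    dotProduct_comm (hat q *ᵥ p) p, h1, h2]
  linear_combination 4 * (p ⬝ᵥ p) * hq

section AttitudeError

variable {A B : Matrix (Fin 3) (Fin 3) ℝ} {c₁ c₂ : ℝ}

lemma SO3.trace_le (hA : SO3 A) : A.trace ≤ 3 := by
  obtain ⟨q₀, q, hq, rfl⟩ := hA.exists_quatRot
  have : 0 ≤ q ⬝ᵥ q := dotProduct_self_star_nonneg q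
  rw [quatRot_trace]
  linarith

lemma SO3.neg_one_le_trace (hA : SO3 A) : -1 ≤ A.trace := by
  obtain ⟨q₀, q, hq, rfl⟩ := hA.exists_quatRot
  rw [quatRot_trace]
  linarith [sq_nonneg q₀]

lemma SO3.configError_bounds (hA : SO3 A) (hB : Bᵀ = B)
    (h : ∀ x, c₁ * (x ⬝ᵥ x) ≤ x ⬝ᵥ (pairSum B *ᵥ x) ∧ x ⬝ᵥ (pairSum B *ᵥ x) ≤ c₂ * (x ⬝ᵥ x)) :
    c₁ * (3 - A.trace) ≤ 2 * (B.trace - (B * A).trace) ∧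
      2 * (B.trace - (B * A).trace) ≤ c₂ * (3 - A.trace) := by
  obtain ⟨q₀, q, hq, rfl⟩ := hA.exists_quatRot
  rw [trace_mul_quatRot hB, quatRot_trace]
  constructor <;> linarith [(h q).1, (h q).2]

lemma SO3.vee_mul_sub_dotProduct_self_le (hA : SO3 A) (hB : Bᵀ = B) (hc₁ : 0 ≤ c₁) (hc₂ : 0 < c₂)
    (h : ∀ x, c₁ * (x ⬝ᵥ x) ≤ x ⬝ᵥ (pairSum B *ᵥ x) ∧ x ⬝ᵥ (pairSum B *ᵥ x) ≤ c₂ * (x ⬝ᵥ x)) :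
    vee (B * A - (B * A)ᵀ) ⬝ᵥ vee (B * A - (B * A)ᵀ) ≤ c₂ ^ 2 * (3 - A.trace) := by
  obtain ⟨q₀, q, hq, rfl⟩ := hA.exists_quatRot
  rw [vee_mul_quatRot_dotProduct_self hB hq, quatRot_trace]
  have h1 := pairSum_norm_sq_le hB hc₂ (fun x =>
    ⟨(mul_nonneg hc₁ (dotProduct_self_star_nonneg x)).trans (h x).1, (h x).2⟩) q
  linarith [sq_nonneg (q ⬝ᵥ (pairSum B *ᵥ q))]

lemma SO3.le_vee_mul_sub_dotProduct_self (hA : SO3 A) (hB : Bᵀ = B) (hc₁ : 0 ≤ c₁)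
    (h : ∀ x, c₁ * (x ⬝ᵥ x) ≤ x ⬝ᵥ (pairSum B *ᵥ x)) :
    c₁ ^ 2 * ((3 - A.trace) * (1 + A.trace)) ≤
      4 * (vee (B * A - (B * A)ᵀ) ⬝ᵥ vee (B * A - (B * A)ᵀ)) := by
  obtain ⟨q₀, q, hq, rfl⟩ := hA.exists_quatRot
  rw [vee_mul_quatRot_dotProduct_self hB hq, quatRot_trace]
  have h1 := dotProduct_sq_le q (pairSum B *ᵥ q)
  have h2 := h q
  set p := pairSum B *ᵥ q
  have hs : 0 ≤ q ⬝ᵥ q := dotProduct_self_star_nonneg q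
  have hp : 0 ≤ p ⬝ᵥ p := dotProduct_self_star_nonneg p
  generalize q ⬝ᵥ q = s at *
  generalize p ⬝ᵥ p = P at *
  generalize q ⬝ᵥ p = m at *
  have hs1 : s ≤ 1 := by linarith [sq_nonneg q₀]
  rcases hs.eq_or_lt with rfl | hs0
  · have : m = 0 := by nlinarith
    subst this
    linarith
  have h3 : (c₁ * s) ^ 2 ≤ m ^ 2 := by gcongr
  have h4 : 0 ≤ (m ^ 2 - (c₁ * s) ^ 2) * (1 - s) :=
    mul_nonneg (by linarith) (by linarith)
  have h5 : s * (c₁ ^ 2 * s * (1 - s)) ≤ s * (P - m ^ 2) := by nlinarith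
  have h6 := le_of_mul_le_mul_left h5 hs0
  nlinarith

lemma SO3.vee_sub_dotProduct_self_le (hA : SO3 A) :
    vee (A - Aᵀ) ⬝ᵥ vee (A - Aᵀ) ≤ 4 * (3 - A.trace) := by
  have h : ∀ x : Fin 3 → ℝ, 2 * (x ⬝ᵥ x) ≤ x ⬝ᵥ (pairSum 1 *ᵥ x) ∧
      x ⬝ᵥ (pairSum 1 *ᵥ x) ≤ 2 * (x ⬝ᵥ x) := by
    intro x
    simp [pairSum, sub_mulVec, smul_mulVec]
    constructor <;> linarith
  have := hA.vee_mul_sub_dotProduct_self_le (transpose_one) two_pos.le two_pos h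
  rw [one_mul] at this
  linarith

end AttitudeError

section Norms

lemma vnorm_nonneg {k : ℕ} (x : Fin k → ℝ) : 0 ≤ vnorm x := Real.sqrt_nonneg _

lemma vnorm_sq {k : ℕ} (x : Fin k → ℝ) : vnorm x ^ 2 = x ⬝ᵥ x :=
  Real.sq_sqrt (dotProduct_self_star_nonneg x)

lemma abs_dotProduct_le (x y : Fin 3 → ℝ) : |x ⬝ᵥ y| ≤ vnorm x * vnorm y :=
  abs_le_of_sq_le_sq (by rw [mul_pow, vnorm_sq, vnorm_sq]; exact dotProduct_sq_le x y)
    (mul_nonneg (vnorm_nonneg x) (vnorm_nonneg y))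

lemma vnorm_hat_mulVec_le (x y : Fin 3 → ℝ) : vnorm (hat x *ᵥ y) ≤ vnorm x * vnorm y :=
  le_of_sq_le_sq (by
    rw [mul_pow, vnorm_sq, vnorm_sq, vnorm_sq, hat_mulVec_dotProduct_self]
    linarith [sq_nonneg (x ⬝ᵥ y)]) (mul_nonneg (vnorm_nonneg x) (vnorm_nonneg y))

lemma vnorm_mulVec_of_transpose_mul_self {A : Matrix (Fin 3) (Fin 3) ℝ} (hA : Aᵀ * A = 1)
    (x : Fin 3 → ℝ) : vnorm (A *ᵥ x) = vnorm x := by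
  rw [vnorm, vnorm, dotProduct_mulVec, ← mulVec_transpose, mulVec_mulVec, hA, one_mulVec]

lemma finner_eq_sum (A B : Matrix (Fin 3) (Fin 3) ℝ) :
    finner A B = ∑ i, ∑ j, A i j * B i j := by
  rw [Finset.sum_comm]
  simp [finner, trace, mul_apply]

lemma finner_self_nonneg (A : Matrix (Fin 3) (Fin 3) ℝ) : 0 ≤ finner A A := by
  rw [finner_eq_sum]
  exact Finset.sum_nonneg fun i _ => Finset.sum_nonneg fun j _ => mul_self_nonneg _

lemma fnorm_nonneg (A : Matrix (Fin 3) (Fin 3) ℝ) : 0 ≤ fnorm A := Real.sqrt_nonneg _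

lemma fnorm_sq (A : Matrix (Fin 3) (Fin 3) ℝ) : fnorm A ^ 2 = finner A A :=
  Real.sq_sqrt (finner_self_nonneg A)

lemma finner_le_fnorm_mul_fnorm (A B : Matrix (Fin 3) (Fin 3) ℝ) :
    finner A B ≤ fnorm A * fnorm B := by
  refine le_of_sq_le_sq ?_ (mul_nonneg (fnorm_nonneg A) (fnorm_nonneg B))
  rw [mul_pow, fnorm_sq, fnorm_sq]
  simp only [finner_eq_sum, ← Fintype.sum_prod_type', ← sq]
  exact Finset.sum_mul_sq_le_sq_mul_sq _ (fun p : Fin 3 × Fin 3 => A p.1 p.2) (fun p => B p.1 p.2)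

lemma fnorm_mul_le (A B : Matrix (Fin 3) (Fin 3) ℝ) : fnorm (A * B) ≤ fnorm A * fnorm B := by
  refine le_of_sq_le_sq ?_ (mul_nonneg (fnorm_nonneg A) (fnorm_nonneg B))
  rw [mul_pow, fnorm_sq, fnorm_sq, fnorm_sq, finner_eq_sum, finner_eq_sum, finner_eq_sum,
    Finset.sum_comm (f := fun i j => B i j * B i j), Finset.sum_mul_sum]
  refine Finset.sum_le_sum fun i _ => Finset.sum_le_sum fun j _ => ?_
  simp only [mul_apply, ← sq]
  exact Finset.sum_mul_sq_le_sq_mul_sq _ _ _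

lemma finner_mul_self_le (H E : Matrix (Fin 3) (Fin 3) ℝ) :
    finner (H * E) E ≤ fnorm H * finner E E := by
  calc finner (H * E) E ≤ fnorm (H * E) * fnorm E := finner_le_fnorm_mul_fnorm _ _
    _ ≤ fnorm H * fnorm E * fnorm E := by
      gcongr
      · exact fnorm_nonneg E
      · exact fnorm_mul_le H E
    _ = fnorm H * finner E E := by rw [mul_assoc, ← sq, fnorm_sq]

end Norms

section Eigenvalues

variable (M : Matrix (Fin 2) (Fin 2) ℝ) (x y : ℝ)

lemma binary_form_nonneg {p m r : ℝ} (hp : 0 ≤ p) (hr : 0 ≤ r) (h : p * r = m ^ 2) :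
    0 ≤ p * x ^ 2 + 2 * m * (x * y) + r * y ^ 2 := by
  rcases hp.eq_or_lt with rfl | hp
  · have : m = 0 := by nlinarith
    subst this
    have := mul_nonneg hr (sq_nonneg y)
    linarith
  · have : 0 ≤ p * (p * x ^ 2 + 2 * m * (x * y) + r * y ^ 2) := by
      have := sq_nonneg (p * x + m * y)
      linear_combination this - y ^ 2 * h
    exact nonneg_of_mul_nonneg_right this hp

lemma lamMin_mul_le :
    lamMin M * (x ^ 2 + y ^ 2) ≤ M 0 0 * x ^ 2 + 2 * M 0 1 * (x * y) + M 1 1 * y ^ 2 := by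
  have hD : 0 ≤ (M 0 0 - M 1 1) ^ 2 + 4 * M 0 1 ^ 2 := by positivity
  have h1 := Real.sq_sqrt hD
  have h2 : |M 0 0 - M 1 1| ≤ √((M 0 0 - M 1 1) ^ 2 + 4 * M 0 1 ^ 2) :=
    Real.abs_le_sqrt (by linarith [sq_nonneg (M 0 1)])
  rw [abs_le] at h2
  have := binary_form_nonneg x y (m := M 0 1)
    (p := (M 0 0 - M 1 1 + √((M 0 0 - M 1 1) ^ 2 + 4 * M 0 1 ^ 2)) / 2)
    (r := (√((M 0 0 - M 1 1) ^ 2 + 4 * M 0 1 ^ 2) - (M 0 0 - M 1 1)) / 2)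
    (by linarith) (by linarith) (by linear_combination h1 / 4)
  rw [lamMin]
  linarith

lemma le_lamMax_mul :
    M 0 0 * x ^ 2 + 2 * M 0 1 * (x * y) + M 1 1 * y ^ 2 ≤ lamMax M * (x ^ 2 + y ^ 2) := by
  have h := lamMin_mul_le (-M) x y
  have hneg : lamMin (-M) = -lamMax M := by
    simp only [lamMin, lamMax, Matrix.neg_apply]
    rw [show (-M 0 0 - -M 1 1) ^ 2 + 4 * (-M 0 1) ^ 2 = (M 0 0 - M 1 1) ^ 2 + 4 * M 0 1 ^ 2 by ring]
    ring
  rw [hneg] at h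
  simp only [Matrix.neg_apply] at h
  linarith

lemma lamMin_pos {M : Matrix (Fin 2) (Fin 2) ℝ} (h₀ : 0 < M 0 0) (h₁ : 0 < M 1 1)
    (hdet : M 0 1 ^ 2 < M 0 0 * M 1 1) : 0 < lamMin M := by
  have : √((M 0 0 - M 1 1) ^ 2 + 4 * M 0 1 ^ 2) < M 0 0 + M 1 1 := by
    rw [Real.sqrt_lt' (by linarith)]
    linarith
  rw [lamMin]
  linarith

end Eigenvalues

section Comparison

lemma le_of_hasDerivAt_nonpos_of_lt {f f' : ℝ → ℝ} {c : ℝ}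
    (hf : ∀ t ≥ 0, HasDerivAt f (f' t) t) (hneg : ∀ t ≥ 0, f t < c → f' t ≤ 0) (h0 : f 0 < c)
    {t : ℝ} (ht : 0 ≤ t) : f t ≤ f 0 := by
  have key : ∀ ε > 0, f 0 + ε * t < c → f t ≤ f 0 + ε * t := by
    intro ε hε hc
    refine image_le_of_deriv_right_lt_deriv_boundary (f := f) (f' := f') (a := 0) (b := t)
      (B := fun s => f 0 + ε * s) (B' := fun _ => ε)
      (fun s hs => (hf s hs.1).continuousAt.continuousWithinAt)
      (fun s hs => (hf s hs.1).hasDerivWithinAt) (by simp) ?_ ?_ (Set.right_mem_Icc.mpr ht)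
    · intro s
      simpa using ((hasDerivAt_id s).const_mul ε).const_add (f 0)
    · intro s hs hfs
      refine (hneg s hs.1 ?_).trans_lt hε
      rw [hfs]
      have : ε * s ≤ ε * t := by gcongr; exact hs.2.le
      linarith
  refine le_of_forall_pos_lt_add fun δ hδ => ?_
  have hm : 0 < min δ (c - f 0) := lt_min hδ (by linarith)
  have hlt : min δ (c - f 0) / (t + 1) * t < min δ (c - f 0) := by
    rw [div_mul_eq_mul_div, div_lt_iff₀ (by linarith)]
    nlinarith
  have := key (min δ (c - f 0) / (t + 1)) (by positivity)
    (by linarith [min_le_right δ (c - f 0)])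
  linarith [min_le_left δ (c - f 0)]

lemma le_mul_exp_of_hasDerivAt_le {f f' : ℝ → ℝ} {r : ℝ}
    (hf : ∀ t ≥ 0, HasDerivAt f (f' t) t) (hle : ∀ t ≥ 0, f' t ≤ -r * f t)
    {t : ℝ} (ht : 0 ≤ t) : f t ≤ f 0 * Real.exp (-r * t) := by
  have hg : ∀ s ≥ 0, HasDerivAt (fun s => f s * Real.exp (r * s))
      (f' s * Real.exp (r * s) + f s * (Real.exp (r * s) * r)) s := by
    intro s hs
    have : HasDerivAt (fun s => r * s) r s := by simpa using (hasDerivAt_id s).const_mul r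
    exact (hf s hs).mul this.exp
  have h := le_of_hasDerivAt_nonpos_of_lt (c := f 0 + 1) hg (fun s hs _ => by
    have := mul_le_mul_of_nonneg_right (hle s hs) (Real.exp_pos (r * s)).le
    linarith) (by simp) ht
  simp only [mul_zero, Real.exp_zero, mul_one] at h
  calc f t = f t * Real.exp (r * t) * Real.exp (-r * t) := by
        rw [mul_assoc, ← Real.exp_add]; simp
    _ ≤ f 0 * Real.exp (-r * t) := by gcongr

end Comparison

section MatrixDerivative

/-- `A` is a matrix-valued curve whose entries have the entries of `A'` as derivatives at `t`. -/
def HasEntryDerivAt (A : ℝ → Matrix (Fin 3) (Fin 3) ℝ) (A' : Matrix (Fin 3) (Fin 3) ℝ)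
    (t : ℝ) : Prop :=
  ∀ i j, HasDerivAt (fun τ => A τ i j) (A' i j) t

variable {A B : ℝ → Matrix (Fin 3) (Fin 3) ℝ} {A' B' : Matrix (Fin 3) (Fin 3) ℝ} {t : ℝ}

lemma HasEntryDerivAt.mul (hA : HasEntryDerivAt A A' t) (hB : HasEntryDerivAt B B' t) :
    HasEntryDerivAt (fun τ => A τ * B τ) (A' * B t + A t * B') t := by
  intro i j
  simp only [mul_apply, Matrix.add_apply, ← Finset.sum_add_distrib]
  exact HasDerivAt.fun_sum fun k _ => (hA i k).mul (hB k j)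

lemma HasEntryDerivAt.transpose (hA : HasEntryDerivAt A A' t) :
    HasEntryDerivAt (fun τ => (A τ)ᵀ) A'ᵀ t :=
  fun i j => hA j i

lemma HasEntryDerivAt.trace (hA : HasEntryDerivAt A A' t) :
    HasDerivAt (fun τ => (A τ).trace) A'.trace t :=
  HasDerivAt.fun_sum fun i _ => hA i i

lemma HasEntryDerivAt.vee_sub_transpose (hA : HasEntryDerivAt A A' t) :
    HasDerivAt (fun τ => vee (A τ - (A τ)ᵀ)) (vee (A' - A'ᵀ)) t := by
  rw [hasDerivAt_pi]
  intro i
  fin_cases i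
  · exact (hA 2 1).sub (hA 1 2)
  · exact (hA 0 2).sub (hA 2 0)
  · exact (hA 1 0).sub (hA 0 1)

lemma HasDerivAt.dotProduct {x y : ℝ → Fin 3 → ℝ} {x' y' : Fin 3 → ℝ}
    (hx : HasDerivAt x x' t) (hy : HasDerivAt y y' t) :
    HasDerivAt (fun τ => x τ ⬝ᵥ y τ) (x' ⬝ᵥ y t + x t ⬝ᵥ y') t := by
  rw [hasDerivAt_pi] at hx hy
  simp only [_root_.dotProduct, ← Finset.sum_add_distrib]
  exact HasDerivAt.fun_sum fun i _ => (hx i).mul (hy i)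

end MatrixDerivative

section Kinematics

lemma SO3.transpose_mul {R S : Matrix (Fin 3) (Fin 3) ℝ} (hR : SO3 R) (hS : SO3 S) :
    SO3 (Rᵀ * S) := by
  refine ⟨?_, by rw [det_mul, det_transpose, hR.2, hS.2, one_mul]⟩
  rw [Matrix.transpose_mul, transpose_transpose, mul_assoc, ← mul_assoc R,
    mul_eq_one_comm.mp hR.1, one_mul, hS.1]

lemma SO3.trace_transpose_mul_mul {R : Matrix (Fin 3) (Fin 3) ℝ} (hR : SO3 R)
    (H : Matrix (Fin 3) (Fin 3) ℝ) : (Rᵀ * H * R).trace = H.trace := by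
  rw [trace_mul_comm, ← mul_assoc, mul_eq_one_comm.mp hR.1, one_mul]

lemma SO3.charpoly_transpose_mul_mul {R : Matrix (Fin 3) (Fin 3) ℝ} (hR : SO3 R)
    (H : Matrix (Fin 3) (Fin 3) ℝ) : (Rᵀ * H * R).charpoly = H.charpoly := by
  rw [charpoly_mul_comm, ← mul_assoc, mul_eq_one_comm.mp hR.1, one_mul]

lemma SO3.finner_mul_sub {R S H : Matrix (Fin 3) (Fin 3) ℝ} (hR : SO3 R) (hS : SO3 S)
    (hH : Hᵀ = H) :
    finner (H * (R - S)) (R - S) = 2 * (H.trace - (Rᵀ * H * S).trace) := by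
  have h : (Sᵀ * H * R).trace = (Rᵀ * H * S).trace := by
    rw [← trace_transpose]
    simp [Matrix.transpose_mul, hH, mul_assoc]
  rw [finner, Matrix.transpose_mul, hH, transpose_sub, Matrix.mul_sub, Matrix.sub_mul,
    Matrix.sub_mul, Matrix.sub_mul, trace_sub, trace_sub, trace_sub,
    hR.trace_transpose_mul_mul, hS.trace_transpose_mul_mul, h]
  ring

lemma SO3.fnorm_sub_sq {R S : Matrix (Fin 3) (Fin 3) ℝ} (hR : SO3 R) (hS : SO3 S) :
    fnorm (R - S) ^ 2 = 2 * (3 - (Rᵀ * S).trace) := by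
  have h := hR.finner_mul_sub hS transpose_one
  rw [fnorm_sq]
  simpa using h

lemma trace_hat_conj (M : Matrix (Fin 3) (Fin 3) ℝ) (x y : Fin 3 → ℝ) :
    ((hat x)ᵀ * M + M * hat (x + y)).trace = -(y ⬝ᵥ vee (M - Mᵀ)) := by
  simp [hat, vee, trace, mul_apply, dotProduct, Fin.sum_univ_three]
  ring

lemma vee_hat_conj (M : Matrix (Fin 3) (Fin 3) ℝ) (x y : Fin 3 → ℝ) :
    vee ((hat x)ᵀ * M + M * hat (x + y) - ((hat x)ᵀ * M + M * hat (x + y))ᵀ) =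
      hat (vee (M - Mᵀ)) *ᵥ x + (M.trace • y - Mᵀ *ᵥ y) := by
  ext i
  fin_cases i <;>
    simp [hat, vee, trace, mulVec, mul_apply, dotProduct, Fin.sum_univ_three] <;> ring

variable {R S G : ℝ → Matrix (Fin 3) (Fin 3) ℝ} {G' : Matrix (Fin 3) (Fin 3) ℝ}
  {ω e : Fin 3 → ℝ} {t : ℝ}

lemma hasDerivAt_configError (hR : HasEntryDerivAt R (R t * hat ω) t)
    (hS : HasEntryDerivAt S (S t * hat (ω + e)) t) (hG : HasEntryDerivAt G G' t) :
    HasDerivAt (fun τ => (G τ).trace - ((R τ)ᵀ * G τ * S τ).trace)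
      (G'.trace - ((R t)ᵀ * G' * S t).trace +
        e ⬝ᵥ vee ((R t)ᵀ * G t * S t - ((R t)ᵀ * G t * S t)ᵀ)) t := by
  refine (hG.trace.sub ((hR.transpose.mul hG).mul hS).trace).congr_deriv ?_
  have h := trace_hat_conj ((R t)ᵀ * G t * S t) ω e
  have h2 : (((R t * hat ω)ᵀ * G t + (R t)ᵀ * G') * S t +
      (R t)ᵀ * G t * (S t * hat (ω + e))) = ((R t)ᵀ * G' * S t) +
      ((hat ω)ᵀ * ((R t)ᵀ * G t * S t) + (R t)ᵀ * G t * S t * hat (ω + e)) := by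
    rw [Matrix.transpose_mul]
    noncomm_ring
  rw [h2, trace_add, h]
  ring

lemma hasDerivAt_vee_relative (hR : HasEntryDerivAt R (R t * hat ω) t)
    (hS : HasEntryDerivAt S (S t * hat (ω + e)) t) :
    HasDerivAt (fun τ => vee ((R τ)ᵀ * S τ - ((R τ)ᵀ * S τ)ᵀ))
      (hat (vee ((R t)ᵀ * S t - ((R t)ᵀ * S t)ᵀ)) *ᵥ ω +
        (((R t)ᵀ * S t).trace • e - ((R t)ᵀ * S t)ᵀ *ᵥ e)) t := by
  refine (hR.transpose.mul hS).vee_sub_transpose.congr_deriv ?_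
  rw [← vee_hat_conj, Matrix.transpose_mul, mul_assoc, mul_assoc]

end Kinematics

section Estimates

lemma SO3.cross_term_bound {A : Matrix (Fin 3) (Fin 3) ℝ} (hA : SO3 A) {y e f Ω : Fin 3 → ℝ}
    {kR kγ BΩ c₂ a ζ : ℝ} (hkR : 0 < kR) (hkγ : 0 < kγ) (hc₂ : 0 < c₂) (hζ : 0 ≤ ζ)
    (hΩ : vnorm Ω ≤ BΩ) (htr : 3 - 4 * a ≤ A.trace)
    (he : e ⬝ᵥ e ≤ c₂ ^ 2 * (ζ ^ 2 / 2)) (hf : f ⬝ᵥ f ≤ 2 * ζ ^ 2) :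
    -(-(kγ • e) ⬝ᵥ f + y ⬝ᵥ (hat f *ᵥ Ω + (A.trace • (y - kR • e) - Aᵀ *ᵥ (y - kR • e)))) ≤
      kγ * c₂ * ζ ^ 2 + 2 * √2 * (c₂ * kR + BΩ / 2) * (ζ * vnorm y)
        - 2 * (1 - 2 * a) * vnorm y ^ 2 := by
  have h2 : √2 ^ 2 = 2 := Real.sq_sqrt (by norm_num)
  have hAt : (Aᵀ)ᵀ * Aᵀ = 1 := by rw [transpose_transpose]; exact mul_eq_one_comm.mp hA.1
  have hy := vnorm_nonneg y
  have hen := vnorm_nonneg e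
  have hfn := vnorm_nonneg f
  have he' : vnorm e ≤ c₂ * (√2 / 2) * ζ := le_of_sq_le_sq (by
    rw [vnorm_sq]; linear_combination he - c₂ ^ 2 * ζ ^ 2 / 4 * h2) (by positivity)
  have hf' : vnorm f ≤ √2 * ζ := le_of_sq_le_sq (by
    rw [vnorm_sq, mul_pow, h2]; exact hf) (by positivity)
  have t1 : e ⬝ᵥ f ≤ c₂ * ζ ^ 2 := by
    calc e ⬝ᵥ f ≤ vnorm e * vnorm f := (abs_le.mp (abs_dotProduct_le e f)).2
      _ ≤ (c₂ * (√2 / 2) * ζ) * (√2 * ζ) := by gcongr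
      _ = c₂ * ζ ^ 2 := by linear_combination c₂ * ζ ^ 2 / 2 * h2
  have t2 : -(y ⬝ᵥ (hat f *ᵥ Ω)) ≤ √2 * BΩ * (ζ * vnorm y) := by
    calc -(y ⬝ᵥ (hat f *ᵥ Ω)) ≤ vnorm y * vnorm (hat f *ᵥ Ω) := by
          linarith [(abs_le.mp (abs_dotProduct_le y (hat f *ᵥ Ω))).1]
      _ ≤ vnorm y * (√2 * ζ * BΩ) := by
          gcongr
          exact (vnorm_hat_mulVec_le f Ω).trans
            (mul_le_mul hf' hΩ (vnorm_nonneg Ω) (by positivity))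
      _ = √2 * BΩ * (ζ * vnorm y) := by ring
  have hye : |y ⬝ᵥ e| ≤ vnorm y * (c₂ * (√2 / 2) * ζ) :=
    (abs_dotProduct_le y e).trans (by gcongr)
  have t3 : A.trace * (y ⬝ᵥ e) ≤ 3 * (vnorm y * (c₂ * (√2 / 2) * ζ)) := by
    calc A.trace * (y ⬝ᵥ e) ≤ |A.trace| * |y ⬝ᵥ e| := by
          rw [← abs_mul]; exact le_abs_self _
      _ ≤ 3 * (vnorm y * (c₂ * (√2 / 2) * ζ)) := by
          gcongr
          exact abs_le.mpr ⟨by linarith [hA.neg_one_le_trace], hA.trace_le⟩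
  have t4 : -(y ⬝ᵥ (Aᵀ *ᵥ e)) ≤ vnorm y * (c₂ * (√2 / 2) * ζ) := by
    calc -(y ⬝ᵥ (Aᵀ *ᵥ e)) ≤ vnorm y * vnorm (Aᵀ *ᵥ e) := by
          linarith [(abs_le.mp (abs_dotProduct_le y (Aᵀ *ᵥ e))).1]
      _ ≤ vnorm y * (c₂ * (√2 / 2) * ζ) := by
          rw [vnorm_mulVec_of_transpose_mul_self hAt]
          gcongr
  have t5 : y ⬝ᵥ (Aᵀ *ᵥ y) ≤ vnorm y ^ 2 := by
    have := (abs_le.mp (abs_dotProduct_le y (Aᵀ *ᵥ y))).2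
    rwa [vnorm_mulVec_of_transpose_mul_self hAt, ← sq] at this
  have t6 : (3 - 4 * a) * vnorm y ^ 2 ≤ A.trace * vnorm y ^ 2 := by gcongr
  have s1 := mul_le_mul_of_nonneg_left t1 hkγ.le
  have s3 := mul_le_mul_of_nonneg_left t3 hkR.le
  have s4 := mul_le_mul_of_nonneg_left t4 hkR.le
  simp only [neg_dotProduct, smul_dotProduct, dotProduct_add, dotProduct_sub, dotProduct_smul,
    mulVec_sub, mulVec_smul, smul_sub, smul_eq_mul, ← vnorm_sq y]
  linarith

end Estimates
set_option maxHeartbeats 1000000 in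
/-- Theorem 1 of the paper: local exponential stability of the attitude and
bias observer on `SO(3)` for time-varying reference directions. -/
theorem stmt_16 {n : ℕ}
    (R Rbar : ℝ → Matrix (Fin 3) (Fin 3) ℝ) (Ω : ℝ → Fin 3 → ℝ)
    (γ : Fin 3 → ℝ) (γbar : ℝ → Fin 3 → ℝ)
    (s : Fin n → ℝ → Fin 3 → ℝ) (w : Fin n → ℝ)
    (kR kγ BΩ c₁ c₂ d a μ : ℝ)
    (hSO3 : ∀ t ≥ (0 : ℝ), SO3 (R t) ∧ SO3 (Rbar t))
    (hw : ∀ i, 0 < w i) (hs : ∀ i t, (s i t) ⬝ᵥ (s i t) = 1)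
    (hsdiff : ∀ i t, DifferentiableAt ℝ (s i) t)
    (hΩ : ∀ t ≥ (0 : ℝ), vnorm (Ω t) ≤ BΩ)
    (hkR : 0 < kR) (hkγ : 0 < kγ)
    (G : ℝ → Matrix (Fin 3) (Fin 3) ℝ)
    (hGdef : ∀ t, G t = ∑ i, w i • vecMulVec (s i t) (s i t))
    (eR : ℝ → Fin 3 → ℝ)
    (heR : ∀ t, eR t = vee ((R t)ᵀ * G t * Rbar t - (Rbar t)ᵀ * G t * R t))
    (hRdot : ∀ t ≥ (0 : ℝ), ∀ i j, HasDerivAt (fun τ => R τ i j) ((R t * hat (Ω t)) i j) t)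
    (hRbardot : ∀ t ≥ (0 : ℝ), ∀ i j, HasDerivAt (fun τ => Rbar τ i j)
      ((Rbar t * hat (Ω t + γ - γbar t - kR • eR t)) i j) t)
    (hγbardot : ∀ t ≥ (0 : ℝ), HasDerivAt γbar (kγ • eR t) t)
    (hc₁ : 0 < c₁) (hc₁₂ : c₁ ≤ c₂) (hd : 0 < d)
    (heig : ∀ t ≥ (0 : ℝ), ∃ l1 l2 l3 : ℝ, l1 ≤ l2 ∧ l2 ≤ l3 ∧
      (G t).charpoly = (X - C l1) * (X - C l2) * (X - C l3) ∧
      c₁ ≤ l1 + l2 ∧ l2 + l3 ≤ c₂)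
    (G' : ℝ → Matrix (Fin 3) (Fin 3) ℝ)
    (hG' : ∀ t ≥ (0 : ℝ), ∀ i j, HasDerivAt (fun τ => G τ i j) (G' t i j) t)
    (hGdot : ∀ t ≥ (0 : ℝ), fnorm (G' t) ≤ d)
    (hkRd : kR > 2 * d / c₁ ^ 2)
    (ha : a ∈ Set.Ioo (0 : ℝ) (1 / 2)) (hμ0 : 0 < μ)
    (hμ1 : μ < Real.sqrt (c₁ / (4 * kγ)))
    (hμ2 : μ < ((1 - a) * c₁ ^ 2 * kR - d) / (2 * c₂ * kγ))
    (hμ3 : μ < (1 / 2 * (1 - 2 * a) * ((1 - a) * c₁ ^ 2 * kR - d)) /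
      ((c₂ * kR + BΩ / 2) ^ 2 + c₂ * kR * (1 - 2 * a)))
    (M₁ M₂ M₃ : Matrix (Fin 2) (Fin 2) ℝ)
    (hM₁ : M₁ = !![c₁ / 4, -(Real.sqrt 2 / 2 * μ); -(Real.sqrt 2 / 2 * μ), 1 / (2 * kγ)])
    (hM₂ : M₂ = !![c₂ / 4, Real.sqrt 2 / 2 * μ; Real.sqrt 2 / 2 * μ, 1 / (2 * kγ)])
    (hM₃ : M₃ = !![1 / 2 * ((1 - a) * c₁ ^ 2 * kR - d) - μ * c₂ * kγ,
        -(μ * Real.sqrt 2 * (c₂ * kR + BΩ / 2));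
        -(μ * Real.sqrt 2 * (c₂ * kR + BΩ / 2)), 2 * μ * (1 - 2 * a)])
    (β σ : ℝ) (hβ : β = Real.sqrt (lamMax M₂ / lamMin M₁)) (hσ : σ = lamMin M₃ / lamMax M₂)
    (z : ℝ → Fin 2 → ℝ) (hz : ∀ t, z t = ![fnorm (R t - Rbar t), vnorm (γ - γbar t)])
    (hIC : (1 / 2) * finner (G 0 * (R 0 - Rbar 0)) (R 0 - Rbar 0) +
      (1 / (2 * kγ)) * vnorm (γ - γbar 0) ^ 2 ≤ 2 * a * c₁) :
    ∀ t ≥ (0 : ℝ), vnorm (z t) ≤ β * vnorm (z 0) * Real.exp (-(σ / 2) * t) := by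
  obtain ⟨ha0, ha2⟩ := ha
  have hc₂ : 0 < c₂ := hc₁.trans_le hc₁₂
  have hgain : 2 * d < kR * c₁ ^ 2 := by rwa [gt_iff_lt, div_lt_iff₀ (by positivity)] at hkRd
  have hBΩ : 0 ≤ BΩ := (vnorm_nonneg _).trans (hΩ 0 le_rfl)
  have hr2 : √2 ^ 2 = 2 := Real.sq_sqrt (by norm_num)
  have hGs : ∀ t, (G t)ᵀ = G t := by
    intro t
    simp [hGdef, transpose_sum, transpose_vecMulVec]
  have hG's : ∀ t ≥ 0, (G' t)ᵀ = G' t := by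
    intro t ht
    ext i j
    refine (hG' t ht j i).unique ?_
    simpa only [← transpose_apply (G _) j i, hGs] using hG' t ht i j
  set ζ : ℝ → ℝ := fun t => fnorm (R t - Rbar t) with hζ
  set y : ℝ → Fin 3 → ℝ := fun t => γ - γbar t with hy
  set f : ℝ → Fin 3 → ℝ := fun t => vee ((R t)ᵀ * Rbar t - ((R t)ᵀ * Rbar t)ᵀ) with hf
  set Ψ : ℝ → ℝ := fun t => (G t).trace - ((R t)ᵀ * G t * Rbar t).trace with hΨ
  have hζ0 : ∀ t, 0 ≤ ζ t := fun t => fnorm_nonneg _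
  have hζsq : ∀ t ≥ 0, ζ t ^ 2 = 2 * (3 - ((R t)ᵀ * Rbar t).trace) := fun t ht =>
    (hSO3 t ht).1.fnorm_sub_sq (hSO3 t ht).2
  have hA : ∀ t ≥ 0, SO3 ((R t)ᵀ * Rbar t) := fun t ht =>
    (hSO3 t ht).1.transpose_mul (hSO3 t ht).2
  have heR' : ∀ t, eR t = vee ((R t)ᵀ * G t * Rbar t - ((R t)ᵀ * G t * Rbar t)ᵀ) := by
    intro t
    rw [heR]
    simp [Matrix.transpose_mul, hGs, mul_assoc]
  have hBs : ∀ t, ((R t)ᵀ * G t * R t)ᵀ = (R t)ᵀ * G t * R t := by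
    intro t
    simp [Matrix.transpose_mul, hGs, mul_assoc]
  have hBA : ∀ t ≥ 0, (R t)ᵀ * G t * R t * ((R t)ᵀ * Rbar t) = (R t)ᵀ * G t * Rbar t := by
    intro t ht
    rw [mul_assoc _ (R t), ← mul_assoc (R t), mul_eq_one_comm.mp (hSO3 t ht).1.1, one_mul]
  have hquad : ∀ t ≥ 0, ∀ x,
      c₁ * (x ⬝ᵥ x) ≤ x ⬝ᵥ (pairSum ((R t)ᵀ * G t * R t) *ᵥ x) ∧
        x ⬝ᵥ (pairSum ((R t)ᵀ * G t * R t) *ᵥ x) ≤ c₂ * (x ⬝ᵥ x) := by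
    intro t ht
    obtain ⟨l₁, l₂, l₃, h₁₂, h₂₃, hchar, hl₁, hl₂⟩ := heig t ht
    rw [← (hSO3 t ht).1.charpoly_transpose_mul_mul] at hchar
    exact pairSum_quadratic_form_bounds (hBs t) hchar h₁₂ h₂₃ hl₁ hl₂
  have hΨbd : ∀ t ≥ 0, c₁ / 4 * ζ t ^ 2 ≤ Ψ t ∧ Ψ t ≤ c₂ / 4 * ζ t ^ 2 := by
    intro t ht
    have h := (hA t ht).configError_bounds (hBs t) (hquad t ht)
    rw [hBA t ht, (hSO3 t ht).1.trace_transpose_mul_mul] at h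
    rw [hζsq t ht]
    constructor <;> linarith [h.1, h.2]
  have heRle : ∀ t ≥ 0, eR t ⬝ᵥ eR t ≤ c₂ ^ 2 * (ζ t ^ 2 / 2) := by
    intro t ht
    have h := (hA t ht).vee_mul_sub_dotProduct_self_le (hBs t) hc₁.le hc₂ (hquad t ht)
    rw [hBA t ht, ← heR' t] at h
    rw [hζsq t ht]
    linarith
  have hleeR : ∀ t ≥ 0, c₁ ^ 2 * (ζ t ^ 2 / 2 * (4 - ζ t ^ 2 / 2)) ≤ 4 * (eR t ⬝ᵥ eR t) := by
    intro t ht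
    have h := (hA t ht).le_vee_mul_sub_dotProduct_self (hBs t) hc₁.le
      (fun x => (hquad t ht x).1)
    rw [hBA t ht, ← heR' t] at h
    rw [hζsq t ht]
    linarith
  have hfle : ∀ t ≥ 0, f t ⬝ᵥ f t ≤ 2 * ζ t ^ 2 := by
    intro t ht
    rw [hζsq t ht]
    linarith [(hA t ht).vee_sub_dotProduct_self_le]
  have hG'le : ∀ t ≥ 0,
      (G' t).trace - ((R t)ᵀ * G' t * Rbar t).trace ≤ d / 2 * ζ t ^ 2 := by
    intro t ht
    have h := (hSO3 t ht).1.finner_mul_sub (hSO3 t ht).2 (hG's t ht)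
    have h2 := finner_mul_self_le (G' t) (R t - Rbar t)
    have h3 := mul_le_mul_of_nonneg_right (hGdot t ht) (finner_self_nonneg (R t - Rbar t))
    rw [← fnorm_sq] at h2 h3
    linarith
  have hy' : ∀ t ≥ 0, HasDerivAt y (-(kγ • eR t)) t := fun t ht =>
    (hγbardot t ht).const_sub γ
  have hS' : ∀ t ≥ 0,
      HasEntryDerivAt Rbar (Rbar t * hat (Ω t + (y t - kR • eR t))) t := by
    intro t ht i j
    rw [hy, ← add_sub_assoc, ← add_sub_assoc]
    exact hRbardot t ht i j
  have hΨ' : ∀ t ≥ 0, HasDerivAt Ψ ((G' t).trace - ((R t)ᵀ * G' t * Rbar t).trace +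
      (y t - kR • eR t) ⬝ᵥ eR t) t := by
    intro t ht
    rw [heR' t, ← heR' t]
    have := hasDerivAt_configError (hRdot t ht) (hS' t ht) (hG' t ht)
    rwa [← heR' t] at this
  set V₀ : ℝ → ℝ := fun t => Ψ t + 1 / (2 * kγ) * (y t ⬝ᵥ y t) with hV₀
  have hV₀' : ∀ t ≥ 0, HasDerivAt V₀
      ((G' t).trace - ((R t)ᵀ * G' t * Rbar t).trace - kR * (eR t ⬝ᵥ eR t)) t := by
    intro t ht
    refine ((hΨ' t ht).add (((hy' t ht).dotProduct (hy' t ht)).const_mul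
      (1 / (2 * kγ)))).congr_deriv ?_
    simp only [sub_dotProduct, neg_dotProduct, dotProduct_neg, smul_dotProduct, dotProduct_smul,
      smul_eq_mul, dotProduct_comm (eR t) (y t)]
    field_simp
    ring
  have hyy : ∀ t, 0 ≤ 1 / (2 * kγ) * (y t ⬝ᵥ y t) := fun t =>
    mul_nonneg (by positivity) (dotProduct_self_star_nonneg (y t))
  have hV₀le : V₀ 0 ≤ 2 * a * c₁ := by
    rw [(hSO3 0 le_rfl).1.finner_mul_sub (hSO3 0 le_rfl).2 (hGs 0), vnorm_sq] at hIC
    simp only [hV₀, hΨ, hy]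
    linarith
  have hac : 2 * a * c₁ < c₁ := mul_lt_of_lt_one_left hc₁ (by linarith)
  have hV₀anti : ∀ t ≥ 0, V₀ t ≤ V₀ 0 := by
    intro t ht
    refine le_of_hasDerivAt_nonpos_of_lt (c := c₁) hV₀' ?_ (hV₀le.trans_lt hac) ht
    intro s hs hVs
    have h1 : c₁ / 4 * ζ s ^ 2 < c₁ := by linarith [(hΨbd s hs).1, hyy s]
    have h2 : ζ s ^ 2 < 4 := lt_of_mul_lt_mul_left (by linarith) hc₁.le
    have h3 := hG'le s hs
    have h4 := mul_le_mul_of_nonneg_left (hleeR s hs) hkR.le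
    have h5 : d * (ζ s ^ 2 / 2) ≤ kR * c₁ ^ 2 / 2 * (ζ s ^ 2 / 2) := by
      gcongr
      linarith
    have h6 : 0 ≤ kR * c₁ ^ 2 * (ζ s ^ 2 / 2) * (2 - ζ s ^ 2 / 2) :=
      mul_nonneg (by positivity) (by linarith)
    linarith
  have hζle : ∀ t ≥ 0, ζ t ^ 2 ≤ 8 * a := by
    intro t ht
    have h1 : c₁ * (ζ t ^ 2) ≤ c₁ * (8 * a) := by
      linarith [(hΨbd t ht).1, hyy t, hV₀anti t ht]
    exact le_of_mul_le_mul_left h1 hc₁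
  have hV₀'le : ∀ t ≥ 0,
      (G' t).trace - ((R t)ᵀ * G' t * Rbar t).trace - kR * (eR t ⬝ᵥ eR t) ≤
        -(1 / 2 * ((1 - a) * c₁ ^ 2 * kR - d)) * ζ t ^ 2 := by
    intro t ht
    have h3 := hG'le t ht
    have h4 := mul_le_mul_of_nonneg_left (hleeR t ht) hkR.le
    have h6 : 0 ≤ kR * c₁ ^ 2 * (ζ t ^ 2 / 2) * (4 * a - ζ t ^ 2 / 2) :=
      mul_nonneg (by positivity) (by linarith [hζle t ht])
    linarith
  set V : ℝ → ℝ := fun t => V₀ t - μ * (y t ⬝ᵥ f t) with hV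
  have hV' : ∀ t ≥ 0, HasDerivAt V
      ((G' t).trace - ((R t)ᵀ * G' t * Rbar t).trace - kR * (eR t ⬝ᵥ eR t) -
        μ * (-(kγ • eR t) ⬝ᵥ f t + y t ⬝ᵥ (hat (f t) *ᵥ Ω t +
          (((R t)ᵀ * Rbar t).trace • (y t - kR • eR t) -
            ((R t)ᵀ * Rbar t)ᵀ *ᵥ (y t - kR • eR t))))) t := fun t ht =>
    (hV₀' t ht).sub
      (((hy' t ht).dotProduct (hasDerivAt_vee_relative (hRdot t ht) (hS' t ht))).const_mul μ)
  have hM₁form : ∀ x v : ℝ, lamMin M₁ * (x ^ 2 + v ^ 2) ≤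
      c₁ / 4 * x ^ 2 - √2 * μ * (x * v) + 1 / (2 * kγ) * v ^ 2 := by
    intro x v
    have h := lamMin_mul_le M₁ x v
    simp [hM₁] at h ⊢
    linarith
  have hM₂form : ∀ x v : ℝ, c₂ / 4 * x ^ 2 + √2 * μ * (x * v) + 1 / (2 * kγ) * v ^ 2 ≤
      lamMax M₂ * (x ^ 2 + v ^ 2) := by
    intro x v
    have h := le_lamMax_mul M₂ x v
    simp [hM₂] at h ⊢
    linarith
  have hM₃form : ∀ x v : ℝ, lamMin M₃ * (x ^ 2 + v ^ 2) ≤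
      (1 / 2 * ((1 - a) * c₁ ^ 2 * kR - d) - μ * c₂ * kγ) * x ^ 2 -
        2 * (μ * √2 * (c₂ * kR + BΩ / 2)) * (x * v) + 2 * μ * (1 - 2 * a) * v ^ 2 := by
    intro x v
    have h := lamMin_mul_le M₃ x v
    simp [hM₃] at h ⊢
    linarith
  have hM₁pos : 0 < lamMin M₁ := by
    have hμsq : μ ^ 2 < c₁ / (4 * kγ) := (Real.lt_sqrt hμ0.le).mp hμ1
    refine lamMin_pos ?_ ?_ ?_ <;> simp only [hM₁, of_apply, cons_val', cons_val_zero,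
      cons_val_one, cons_val_fin_one]
    · positivity
    · positivity
    · have : c₁ / 4 * (1 / (2 * kγ)) = c₁ / (4 * kγ) / 2 := by field_simp
      rw [this]
      linear_combination hμsq / 2 + μ ^ 2 / 4 * hr2
  have hM₂pos : 0 < lamMax M₂ := by
    have h := hM₂form 1 0
    norm_num at h
    linarith
  have hXle : ∀ t ≥ 0, |y t ⬝ᵥ f t| ≤ √2 * (ζ t * vnorm (y t)) := by
    intro t ht
    have hf' : vnorm (f t) ≤ √2 * ζ t := le_of_sq_le_sq (by
      rw [vnorm_sq, mul_pow, hr2]; exact hfle t ht) (mul_nonneg (by positivity) (hζ0 t))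
    calc |y t ⬝ᵥ f t| ≤ vnorm (y t) * vnorm (f t) := abs_dotProduct_le _ _
      _ ≤ vnorm (y t) * (√2 * ζ t) := mul_le_mul_of_nonneg_left hf' (vnorm_nonneg _)
      _ = √2 * (ζ t * vnorm (y t)) := by ring
  have hmain : ∀ t ≥ 0, lamMin M₁ * (ζ t ^ 2 + vnorm (y t) ^ 2) ≤
      lamMax M₂ * (ζ 0 ^ 2 + vnorm (y 0) ^ 2) * Real.exp (-σ * t) := by
    rcases le_or_gt (lamMin M₃) 0 with hneg | hpos
    · intro t ht
      have hexp : 1 ≤ Real.exp (-σ * t) := by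
        refine Real.one_le_exp (mul_nonneg ?_ ht)
        rw [hσ, neg_nonneg]
        exact div_nonpos_of_nonpos_of_nonneg hneg hM₂pos.le
      have h1 := hM₁form 1 0
      have h2 := hM₁form 0 1
      norm_num at h1 h2
      have hkγ2 : 1 / (2 * kγ) = kγ⁻¹ * (1 / 2) := by field_simp
      have h3 := mul_le_mul_of_nonneg_right h1 (sq_nonneg (ζ t))
      have h4 := mul_le_mul_of_nonneg_right h2 (sq_nonneg (vnorm (y t)))
      have h5 := hM₂form (ζ 0) (vnorm (y 0))
      have h6 : 0 ≤ √2 * μ * (ζ 0 * vnorm (y 0)) :=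
        mul_nonneg (by positivity) (mul_nonneg (hζ0 0) (vnorm_nonneg _))
      have h7 := hV₀anti t ht
      simp only [hV₀, ← vnorm_sq, hkγ2] at h7
      rw [hkγ2] at h5
      have h8 : lamMin M₁ * (ζ t ^ 2 + vnorm (y t) ^ 2) ≤
          lamMax M₂ * (ζ 0 ^ 2 + vnorm (y 0) ^ 2) := by
        linarith [(hΨbd t ht).1, (hΨbd 0 le_rfl).2]
      exact h8.trans (le_mul_of_one_le_right (by positivity) hexp)
    · intro t ht
      have hVup : ∀ s ≥ 0, V s ≤ lamMax M₂ * (ζ s ^ 2 + vnorm (y s) ^ 2) := by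
        intro s hs
        have h1 := mul_le_mul_of_nonneg_left (hXle s hs) hμ0.le
        have h2 := mul_le_mul_of_nonneg_left (neg_abs_le (y s ⬝ᵥ f s)) hμ0.le
        simp only [hV, hV₀, ← vnorm_sq]
        linarith [hM₂form (ζ s) (vnorm (y s)), (hΨbd s hs).2]
      have hVlow : lamMin M₁ * (ζ t ^ 2 + vnorm (y t) ^ 2) ≤ V t := by
        have h1 := mul_le_mul_of_nonneg_left (hXle t ht) hμ0.le
        have h2 := mul_le_mul_of_nonneg_left (le_abs_self (y t ⬝ᵥ f t)) hμ0.le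
        simp only [hV, hV₀, ← vnorm_sq]
        linarith [hM₁form (ζ t) (vnorm (y t)), (hΨbd t ht).1]
      have hdecay := le_mul_exp_of_hasDerivAt_le (r := σ) hV' (fun s hs => by
        have h1 := (hA s hs).cross_term_bound (y := y s) (a := a) hkR hkγ hc₂ (hζ0 s) (hΩ s hs)
          (by linarith [hζle s hs, hζsq s hs]) (heRle s hs) (hfle s hs)
        have h2 := mul_le_mul_of_nonneg_left h1 hμ0.le
        have h3 := hM₃form (ζ s) (vnorm (y s))
        have h4 : σ * V s ≤ lamMin M₃ * (ζ s ^ 2 + vnorm (y s) ^ 2) := by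
          rw [hσ, div_mul_eq_mul_div, div_le_iff₀ hM₂pos]
          exact (mul_le_mul_of_nonneg_left (hVup s hs) hpos.le).trans_eq (by ring)
        linarith [hV₀'le s hs]) ht
      exact hVlow.trans (hdecay.trans
        (mul_le_mul_of_nonneg_right (hVup 0 le_rfl) (Real.exp_pos _).le))
  intro t ht
  have hzsq : ∀ s, vnorm (z s) ^ 2 = ζ s ^ 2 + vnorm (y s) ^ 2 := by
    intro s
    rw [vnorm_sq, hz]
    simp [dotProduct, Fin.sum_univ_two, hζ, hy]
    ring
  have hβ0 : 0 ≤ β := hβ ▸ Real.sqrt_nonneg _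
  refine le_of_sq_le_sq ?_
    (mul_nonneg (mul_nonneg hβ0 (vnorm_nonneg _)) (Real.exp_pos _).le)
  have hexp : Real.exp (-(σ / 2) * t) ^ 2 = Real.exp (-σ * t) := by
    rw [← Real.exp_nat_mul]
    congr 1
    push_cast
    ring
  rw [mul_pow, mul_pow, hexp, hβ, Real.sq_sqrt (div_pos hM₂pos hM₁pos).le, hzsq, hzsq,
    div_mul_eq_mul_div, div_mul_eq_mul_div, le_div_iff₀ hM₁pos]
  linarith [hmain t ht]
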